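/- Let p ≥ 1. For every κ > 0 there exists a constant C > 0, depending only on A, k, m, n, p and κ, such that for every global weak solution u of the problem, all R > 0 and all R ≤ r_1 < r_2 ≤ 2R, setting I(r) = (mes Q_{2R}^κ)^{−1} ∫_{Q_r^κ} |u|^p dx dt, at least one of the following two inequalities holds: (i) I(r_2) − I(r_1) ≥ C (r_2 − r_1)^{kp} R^{kp(κ−1)} f(I(r_1)^{1/p})^p; (ii) I(r_2) − I(r_1) ≥ C (r_2 − r_1)^m f(I(r_1)^{1/p}). -/

import Mathlib

open MeasureTheory Real Set Filter

noncomputable section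

/-- The spatial domain `ℝⁿ`. -/
abbrev Spc (n : ℕ) := EuclideanSpace ℝ (Fin n)

/-- The open ball `B_r` in `ℝⁿ` of radius `r` centered at `0`. -/
def ball0 (n : ℕ) (r : ℝ) : Set (Spc n) := Metric.ball 0 r

/-- The cylinder `Q_r^κ = B_r × (0, r^κ)`. -/
def cyl (n : ℕ) (r κ : ℝ) : Set (Spc n × ℝ) := ball0 n r ×ˢ Ioo 0 (r ^ κ)

/-- The half-space `ℝ^{n+1}_+ = ℝⁿ × (0, ∞)`. -/
def halfSp (n : ℕ) : Set (Spc n × ℝ) := {z | 0 < z.2}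

/-- The (finite) set of multi-indices `α` with `|α| = m`. -/
def mIdx (n m : ℕ) : Finset (Fin n → ℕ) :=
  (Fintype.piFinset fun _ : Fin n => Finset.range (m + 1)).filter fun α => ∑ i, α i = m

/-- Spatial partial derivative `∂/∂x_i`. -/
def spDeriv (n : ℕ) (i : Fin n) (φ : Spc n × ℝ → ℝ) : Spc n × ℝ → ℝ :=
  fun z => deriv (fun s : ℝ => φ (z.1 + s • EuclideanSpace.single i (1 : ℝ), z.2)) 0

/-- Time derivative `∂/∂t`. -/
def tDeriv (n : ℕ) (φ : Spc n × ℝ → ℝ) : Spc n × ℝ → ℝ :=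
  fun z => deriv (fun s : ℝ => φ (z.1, s)) z.2

/-- Multi-index spatial derivative `∂^α`. -/
def mDeriv (n : ℕ) (α : Fin n → ℕ) (φ : Spc n × ℝ → ℝ) : Spc n × ℝ → ℝ :=
  (List.finRange n).foldr (fun i ψ => (spDeriv n i)^[α i] ψ) φ

/-- Caratheodory conditions and the growth bound `|a_α(x,t,ζ)| ≤ A |ζ|^p` for the
coefficients of the operator `L`. -/
def GoodCoeffs (n m : ℕ) (A p : ℝ) (a : (Fin n → ℕ) → Spc n × ℝ → ℝ → ℝ) : Prop :=
  ∀ α ∈ mIdx n m,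
    (∀ ζ : ℝ, Measurable fun z => a α z ζ) ∧
    (∀ᵐ z ∂(volume.restrict (halfSp n)), Continuous fun ζ => a α z ζ) ∧
    (∀ᵐ z ∂(volume.restrict (halfSp n)), ∀ ζ : ℝ, |a α z ζ| ≤ A * |ζ| ^ p)

/-- The standing conditions on `f`: `ζ ↦ f ζ` and `ζ ↦ f (ζ^{1/p})` are nondecreasing
and convex on `[0,∞)`, and `f` is positive on `(0,∞)`. -/
def GoodF (p : ℝ) (f : ℝ → ℝ) : Prop :=
  MonotoneOn f (Ici 0) ∧ ConvexOn ℝ (Ici 0) f ∧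
  MonotoneOn (fun ζ => f (ζ ^ (1 / p))) (Ici 0) ∧
  ConvexOn ℝ (Ici 0) (fun ζ => f (ζ ^ (1 / p))) ∧
  ∀ ζ : ℝ, 0 < ζ → 0 < f ζ

/-- Condition (1.4): `∫_1^∞ ζ^{1/k - 1} f(ζ)^{-1/k} dζ < ∞`. -/
def Cond14 (k : ℕ) (f : ℝ → ℝ) : Prop :=
  IntegrableOn (fun ζ : ℝ => ζ ^ ((k : ℝ)⁻¹ - 1) / f ζ ^ ((k : ℝ)⁻¹)) (Ioi 1)

/-- Condition (1.5): `∫_1^∞ ζ^{p/m - 1} f(ζ)^{-1/m} dζ < ∞`. -/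
def Cond15 (m : ℕ) (p : ℝ) (f : ℝ → ℝ) : Prop :=
  IntegrableOn (fun ζ : ℝ => ζ ^ (p / (m : ℝ) - 1) / f ζ ^ ((m : ℝ)⁻¹)) (Ioi 1)

/-- `v ∈ L^1_loc(ℝⁿ)`. -/
def L1locInit (n : ℕ) (v : Spc n → ℝ) : Prop :=
  ∀ r : ℝ, 0 < r → IntegrableOn v (ball0 n r)

/-- `u` is a global weak solution of
`∂_t^k u - Σ_{|α| = m} ∂^α a_α(x,t,u) ≥ f(|u|)` in `ℝ^{n+1}_+`, with initial data
`∂_t^i u(·,0) = u0 i` for `0 ≤ i ≤ k-1`. -/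
def IsGlobalWeakSol (n k m : ℕ) (p : ℝ) (a : (Fin n → ℕ) → Spc n × ℝ → ℝ → ℝ)
    (f : ℝ → ℝ) (u0 : ℕ → Spc n → ℝ) (u : Spc n × ℝ → ℝ) : Prop :=
  (∀ r : ℝ, 0 < r → IntegrableOn u (cyl n r 1)) ∧
  (∀ r : ℝ, 0 < r → IntegrableOn (fun z => |u z| ^ p) (cyl n r 1)) ∧
  (∀ r : ℝ, 0 < r → IntegrableOn (fun z => f |u z|) (cyl n r 1)) ∧
  ∀ φ : Spc n × ℝ → ℝ, ContDiff ℝ (⊤ : ℕ∞) φ → HasCompactSupport φ →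
    (∀ z, 0 ≤ φ z) →
    (∫ z in halfSp n, (-1 : ℝ) ^ k * u z * (tDeriv n)^[k] φ z)
      - (∫ z in halfSp n, ∑ α ∈ mIdx n m, (-1 : ℝ) ^ m * a α z (u z) * mDeriv n α φ z)
    ≥ (∫ x : Spc n, ∑ i ∈ Finset.range k,
          (-1 : ℝ) ^ i * u0 (k - 1 - i) x * (tDeriv n)^[i] φ (x, 0))
      + ∫ z in halfSp n, f |u z| * φ z

/-- `u = 0` almost everywhere in `ℝ^{n+1}_+`. -/
def TrivialSol (n : ℕ) (u : Spc n × ℝ → ℝ) : Prop :=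
  ∀ᵐ z ∂(volume.restrict (halfSp n)), u z = 0

/-- The standing hypotheses of Section 3: the coefficients are Caratheodory functions
with the growth bound, `f` satisfies the monotonicity/convexity/positivity conditions
together with (1.4) and (1.5), and the initial data are locally integrable with
`u_{k-1} ≥ 0` a.e. -/
def Standing (n k m : ℕ) (A p : ℝ) (a : (Fin n → ℕ) → Spc n × ℝ → ℝ → ℝ)
    (f : ℝ → ℝ) (u0 : ℕ → Spc n → ℝ) : Prop :=
  GoodCoeffs n m A p a ∧ GoodF p f ∧
  (∀ i < k, L1locInit n (u0 i)) ∧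
  (∀ᵐ x ∂(volume : Measure (Spc n)), 0 ≤ u0 (k - 1) x) ∧
  Cond14 k f ∧ Cond15 m p f

/-- A smooth radial cutoff, equal to `1` for `‖x‖ ≤ a` and to `0` for `b ≤ ‖x‖`. -/
def radialCutoff {E : Type*} [NormedAddCommGroup E] (a b : ℝ) (x : E) : ℝ :=
  smoothTransition ((b ^ 2 - ‖x‖ ^ 2) / (b ^ 2 - a ^ 2))

section RadialCutoff

variable {E : Type*} [NormedAddCommGroup E] {a b : ℝ}

lemma radialCutoff_nonneg (x : E) : 0 ≤ radialCutoff a b x := smoothTransition.nonneg _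

lemma radialCutoff_le_one (x : E) : radialCutoff a b x ≤ 1 := smoothTransition.le_one _

lemma radialCutoff_eq_one (ha : 0 ≤ a) (hab : a < b) {x : E} (hx : ‖x‖ ≤ a) :
    radialCutoff a b x = 1 := by
  have h : 0 < b ^ 2 - a ^ 2 := by nlinarith
  refine smoothTransition.one_of_one_le ((one_le_div h).2 ?_)
  nlinarith [norm_nonneg x]

lemma radialCutoff_eq_zero (ha : 0 ≤ a) (hab : a < b) {x : E} (hx : b ≤ ‖x‖) :
    radialCutoff a b x = 0 := by
  have h : 0 < b ^ 2 - a ^ 2 := by nlinarith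
  refine smoothTransition.zero_of_nonpos (div_nonpos_of_nonpos_of_nonneg ?_ h.le)
  nlinarith [norm_nonneg x]

variable [InnerProductSpace ℝ E]

lemma contDiff_sq_sub_norm_sq_div (a b : ℝ) :
    ContDiff ℝ (⊤ : ℕ∞) fun x : E => (b ^ 2 - ‖x‖ ^ 2) / (b ^ 2 - a ^ 2) :=
  (contDiff_const.sub (contDiff_norm_sq ℝ)).div_const _

lemma contDiff_radialCutoff (a b : ℝ) : ContDiff ℝ (⊤ : ℕ∞) (radialCutoff a b : E → ℝ) :=
  smoothTransition.contDiff.comp (contDiff_sq_sub_norm_sq_div a b)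

lemma iteratedFDeriv_radialCutoff_of_norm_lt (ha : 0 ≤ a) (hab : a < b) {m : ℕ} (hm : m ≠ 0)
    {x : E} (hx : ‖x‖ < a) : iteratedFDeriv ℝ m (radialCutoff a b) x = 0 := by
  have h : (radialCutoff a b : E → ℝ) =ᶠ[nhds x] fun _ => 1 := by
    filter_upwards [continuous_norm.continuousAt.eventually_lt_const hx] with y hy
    exact radialCutoff_eq_one ha hab hy.le
  rw [(h.iteratedFDeriv ℝ m).eq_of_nhds, iteratedFDeriv_const_of_ne hm, Pi.zero_apply]

lemma iteratedFDeriv_radialCutoff_of_lt_norm (ha : 0 ≤ a) (hab : a < b) (m : ℕ)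
    {x : E} (hx : b < ‖x‖) : iteratedFDeriv ℝ m (radialCutoff a b) x = 0 := by
  have h : (radialCutoff a b : E → ℝ) =ᶠ[nhds x] fun _ => 0 := by
    filter_upwards [continuous_norm.continuousAt.eventually_const_lt hx] with y hy
    exact radialCutoff_eq_zero ha hab hy.le
  rw [(h.iteratedFDeriv ℝ m).eq_of_nhds]
  exact congrFun iteratedFDeriv_fun_zero x

lemma norm_iteratedFDeriv_sq_sub_norm_sq_div_le (ha : 0 < a) (hab : a < b) {x : E}
    (hx : ‖x‖ ≤ b) {i : ℕ} (hi : 1 ≤ i) :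
    ‖iteratedFDeriv ℝ i (fun x : E => (b ^ 2 - ‖x‖ ^ 2) / (b ^ 2 - a ^ 2)) x‖
      ≤ (2 / (b - a)) ^ i := by
  have hd : 0 < b - a := sub_pos.2 hab
  have hs : 0 < b ^ 2 - a ^ 2 := by nlinarith
  set L : E →L[ℝ] E →L[ℝ] ℝ := (-(2 / (b ^ 2 - a ^ 2))) • innerSL ℝ with hL
  have hf : fderiv ℝ (fun x : E => (b ^ 2 - ‖x‖ ^ 2) / (b ^ 2 - a ^ 2)) = L := by
    ext1 y
    have h1 := ((((hasStrictFDerivAt_norm_sq y).hasFDerivAt.const_sub (b ^ 2)).mul_const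
      (b ^ 2 - a ^ 2)⁻¹)).fderiv
    simp only [← div_eq_mul_inv] at h1
    rw [h1, hL]
    ext z
    have h2 : (innerSL ℝ : E →L[ℝ] E →L[ℝ] ℝ) y z = inner ℝ y z := innerSL_apply_apply ℝ y z
    simp [h2]
    ring
  have hLn : ∀ y : E, ‖L y‖ ≤ 2 / (b ^ 2 - a ^ 2) * ‖y‖ := fun y => by
    have h2 : ‖(innerSL ℝ : E →L[ℝ] E →L[ℝ] ℝ) y‖ = ‖y‖ := innerSL_apply_norm ℝ y
    simp [hL, norm_smul, abs_of_pos hs, h2]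
  match i, hi with
  | 1, _ =>
    rw [← norm_iteratedFDeriv_fderiv, hf, norm_iteratedFDeriv_zero, pow_one]
    refine (hLn x).trans ?_
    rw [div_mul_eq_mul_div, div_le_div_iff₀ hs hd]
    nlinarith [mul_nonneg hd.le (sub_nonneg.2 hx), mul_pos hd ha]
  | 2, _ =>
    rw [← norm_iteratedFDeriv_fderiv, hf, ← norm_iteratedFDeriv_fderiv, norm_iteratedFDeriv_zero,
      L.fderiv]
    refine (L.opNorm_le_bound (by positivity) hLn).trans ?_
    rw [div_pow, div_le_div_iff₀ hs (by positivity)]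
    nlinarith [mul_pos hd ha]
  | j + 3, _ =>
    rw [← norm_iteratedFDeriv_fderiv, hf, ← norm_iteratedFDeriv_fderiv]
    have : fderiv ℝ (L : E → E →L[ℝ] ℝ) = fun _ => L := funext fun y => L.fderiv
    rw [this, iteratedFDeriv_const_of_ne (Nat.succ_ne_zero j)]
    simp only [Pi.zero_apply, norm_zero]
    positivity

lemma exists_norm_iteratedFDeriv_smoothTransition_le (m : ℕ) :
    ∃ C : ℝ, 0 < C ∧ ∀ i ≤ m, ∀ s ∈ Icc (0 : ℝ) 1,
      ‖iteratedFDeriv ℝ i smoothTransition s‖ ≤ C := by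
  have h : ∀ i : ℕ, ∃ C : ℝ, ∀ s ∈ Icc (0 : ℝ) 1,
      ‖iteratedFDeriv ℝ i smoothTransition s‖ ≤ C := fun i =>
    isCompact_Icc.exists_bound_of_continuousOn
      ((smoothTransition.contDiff (n := ⊤)).continuous_iteratedFDeriv
        (by exact_mod_cast le_top)).continuousOn
  choose C hC using h
  refine ⟨1 + ∑ i ∈ Finset.range (m + 1), |C i|, by positivity, fun i hi s hs => ?_⟩
  have := Finset.single_le_sum (f := fun i => |C i|) (fun j _ => abs_nonneg (C j))
    (Finset.mem_range.2 (Nat.lt_succ_of_le hi))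
  linarith [hC i s hs, le_abs_self (C i)]

lemma exists_norm_iteratedFDeriv_radialCutoff_le (E : Type*) [NormedAddCommGroup E]
    [InnerProductSpace ℝ E] {m : ℕ} (hm : m ≠ 0) :
    ∃ C : ℝ, 0 < C ∧ ∀ a b : ℝ, 0 < a → a < b → ∀ x : E,
      ‖iteratedFDeriv ℝ m (radialCutoff a b) x‖ ≤ C / (b - a) ^ m := by
  obtain ⟨C, hC, h⟩ := exists_norm_iteratedFDeriv_smoothTransition_le m
  refine ⟨m.factorial * C * 2 ^ m, by positivity, fun a b ha hab x => ?_⟩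
  have hd : 0 < b - a := sub_pos.2 hab
  have hs : 0 < b ^ 2 - a ^ 2 := by nlinarith
  rcases lt_or_ge ‖x‖ a with hx | hxa
  · rw [iteratedFDeriv_radialCutoff_of_norm_lt ha.le hab hm hx, norm_zero]
    positivity
  rcases lt_or_ge b ‖x‖ with hx | hxb
  · rw [iteratedFDeriv_radialCutoff_of_lt_norm ha.le hab m hx, norm_zero]
    positivity
  refine (norm_iteratedFDeriv_comp_le (N := ((⊤ : ℕ∞) : WithTop ℕ∞)) smoothTransition.contDiff
    (contDiff_sq_sub_norm_sq_div a b) (by exact_mod_cast le_top) x (C := C) (D := 2 / (b - a))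
    (fun i hi => h i hi _ ⟨div_nonneg ?_ hs.le, (div_le_one hs).2 ?_⟩)
    fun i hi _ => norm_iteratedFDeriv_sq_sub_norm_sq_div_le ha hab hxb hi).trans_eq ?_
  · nlinarith [norm_nonneg x]
  · nlinarith [norm_nonneg x]
  · rw [div_pow]
    ring

end RadialCutoff

section SeparatedDerivatives

variable {n : ℕ} {ψ : Spc n → ℝ} {η : ℝ → ℝ}

/-- `F` is `ψ ⊗ η` differentiated `N` times in space along vectors of norm at most one. -/
def IsSpatialDerivative (ψ : Spc n → ℝ) (η : ℝ → ℝ) (N : ℕ) (F : Spc n × ℝ → ℝ) : Prop :=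
  ∃ v : Fin N → Spc n, (∀ j, ‖v j‖ ≤ 1) ∧ F = fun z => iteratedFDeriv ℝ N ψ z.1 v * η z.2

lemma IsSpatialDerivative.spDeriv (hψ : ContDiff ℝ (⊤ : ℕ∞) ψ) {N : ℕ} {F : Spc n × ℝ → ℝ}
    (h : IsSpatialDerivative ψ η N F) (i : Fin n) :
    IsSpatialDerivative ψ η (N + 1) (spDeriv n i F) := by
  obtain ⟨v, hv, rfl⟩ := h
  refine ⟨Fin.cons (EuclideanSpace.single i (1 : ℝ)) v, fun j => ?_, funext fun z => ?_⟩
  · refine Fin.cases ?_ (fun j => ?_) j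
    · simp
    · simpa using hv j
  · have h1 : HasFDerivAt (iteratedFDeriv ℝ N ψ) (fderiv ℝ (iteratedFDeriv ℝ N ψ) z.1)
        (z.1 + (0 : ℝ) • EuclideanSpace.single i (1 : ℝ)) := by
      rw [zero_smul, add_zero]
      exact (hψ.differentiable_iteratedFDeriv (by exact_mod_cast ENat.natCast_lt_top N) z.1).hasFDerivAt
    have h2 : HasDerivAt (fun s : ℝ => z.1 + s • EuclideanSpace.single i (1 : ℝ))
        (EuclideanSpace.single i (1 : ℝ)) 0 := by
      simpa using ((hasDerivAt_id (0 : ℝ)).smul_const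
        (EuclideanSpace.single i (1 : ℝ))).const_add z.1
    have h3 := (ContinuousMultilinearMap.apply ℝ (fun _ : Fin N => Spc n) ℝ
      v).hasFDerivAt.comp_hasDerivAt (0 : ℝ) (h1.comp_hasDerivAt (0 : ℝ) h2)
    have h4 := (h3.mul_const (η z.2)).deriv
    rw [iteratedFDeriv_succ_apply_left]
    simpa [_root_.spDeriv, Function.comp_def] using h4

lemma IsSpatialDerivative.iterate_spDeriv (hψ : ContDiff ℝ (⊤ : ℕ∞) ψ) {N : ℕ}
    {F : Spc n × ℝ → ℝ} (h : IsSpatialDerivative ψ η N F) (i : Fin n) (s : ℕ) :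
    IsSpatialDerivative ψ η (N + s) ((_root_.spDeriv n i)^[s] F) := by
  induction s with
  | zero => exact h
  | succ s ih =>
    rw [Function.iterate_succ_apply']
    exact ih.spDeriv hψ i

lemma isSpatialDerivative_foldr (hψ : ContDiff ℝ (⊤ : ℕ∞) ψ) (α : Fin n → ℕ)
    (l : List (Fin n)) :
    IsSpatialDerivative ψ η (l.map α).sum
      (l.foldr (fun i F => (spDeriv n i)^[α i] F) fun z => ψ z.1 * η z.2) := by
  induction l with
  | nil => exact ⟨Fin.elim0, fun j => j.elim0, rfl⟩
  | cons i l ih =>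
    rw [List.map_cons, List.sum_cons, List.foldr_cons, add_comm]
    exact ih.iterate_spDeriv hψ i (α i)

lemma abs_mDeriv_le (hψ : ContDiff ℝ (⊤ : ℕ∞) ψ) {m : ℕ} {α : Fin n → ℕ} (hα : α ∈ mIdx n m)
    (z : Spc n × ℝ) :
    |mDeriv n α (fun z => ψ z.1 * η z.2) z| ≤ ‖iteratedFDeriv ℝ m ψ z.1‖ * |η z.2| := by
  have hsum : ((List.finRange n).map α).sum = m := by
    rw [← (Finset.mem_filter.1 hα).2, ← List.ofFn_eq_map, List.sum_ofFn]
  obtain ⟨v, hv, hF⟩ := hsum ▸ isSpatialDerivative_foldr (η := η) hψ α (List.finRange n)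
  rw [mDeriv, hF, abs_mul]
  gcongr
  refine ((iteratedFDeriv ℝ m ψ z.1).le_opNorm v).trans
    (mul_le_of_le_one_right (norm_nonneg _) (Finset.prod_le_one (fun j _ => norm_nonneg _)
      fun j _ => hv j))

lemma iterate_tDeriv (ψ : Spc n → ℝ) (η : ℝ → ℝ) (j : ℕ) :
    (tDeriv n)^[j] (fun z => ψ z.1 * η z.2) = fun z => ψ z.1 * iteratedDeriv j η z.2 := by
  induction j with
  | zero => simp
  | succ j ih =>
    rw [Function.iterate_succ_apply', ih]
    funext z
    simp only [tDeriv, iteratedDeriv_succ]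
    exact deriv_const_mul_field (ψ z.1)

end SeparatedDerivatives

section Convexity

lemma ConvexOn.continuousOn_Ici_of_monotoneOn {g : ℝ → ℝ} (hc : ConvexOn ℝ (Ici 0) g)
    (hm : MonotoneOn g (Ici 0)) : ContinuousOn g (Ici 0) := by
  have himg : (fun x : ℝ => max x 0) '' univ ⊆ Ici 0 := by
    rintro _ ⟨x, -, rfl⟩
    exact le_max_right x 0
  have himgc : Convex ℝ ((fun x : ℝ => max x 0) '' univ) := by
    have : (fun x : ℝ => max x 0) '' univ = Ici 0 :=
      himg.antisymm fun x hx => ⟨x, trivial, max_eq_left hx⟩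
    exact this ▸ convex_Ici 0
  have h : ConvexOn ℝ univ (g ∘ fun x : ℝ => max x 0) :=
    (hc.subset himg himgc).comp
      ((convexOn_id convex_univ).sup (convexOn_const 0 convex_univ)) (hm.mono himg)
  refine (h.continuousOn isOpen_univ).mono (subset_univ _) |>.congr fun x hx => ?_
  simp [max_eq_left (mem_Ici.1 hx)]

lemma ConvexOn.nonneg_zero_of_pos {f : ℝ → ℝ} (hc : ConvexOn ℝ (Ici 0) f)
    (hpos : ∀ ζ, 0 < ζ → 0 < f ζ) (hm : MonotoneOn f (Ici 0)) : 0 ≤ f 0 := by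
  have h1 : Tendsto f (nhdsWithin 0 (Ioi 0)) (nhds (f 0)) :=
    (hc.continuousOn_Ici_of_monotoneOn hm 0 self_mem_Ici).mono_left
      (nhdsWithin_mono _ Ioi_subset_Ici_self)
  refine ge_of_tendsto h1 ?_
  filter_upwards [self_mem_nhdsWithin] with x hx using (hpos x hx).le

lemma GoodF.nonneg {p : ℝ} {f : ℝ → ℝ} (h : GoodF p f) {x : ℝ} (hx : 0 ≤ x) : 0 ≤ f x := by
  rcases hx.eq_or_lt with rfl | hx
  · exact h.2.1.nonneg_zero_of_pos h.2.2.2.2 h.1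
  · exact (h.2.2.2.2 x hx).le

lemma GoodF.apply_rpow_setAverage_le {p : ℝ} (hp : 0 < p) {f : ℝ → ℝ} (h : GoodF p f)
    {X : Type*} [MeasurableSpace X] {μ : Measure X} {S : Set X} {u : X → ℝ} (h0 : μ S ≠ 0)
    (h1 : μ S ≠ ⊤) (hu : IntegrableOn (fun z => |u z| ^ p) S μ)
    (hf : IntegrableOn (fun z => f |u z|) S μ) :
    f ((⨍ z in S, |u z| ^ p ∂μ) ^ (1 / p)) ≤ ⨍ z in S, f |u z| ∂μ := by
  have hr : ∀ z, (|u z| ^ p) ^ (1 / p) = |u z| := fun z => by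
    rw [one_div, Real.rpow_rpow_inv (abs_nonneg _) hp.ne']
  have key := h.2.2.2.1.map_set_average_le (f := fun z => |u z| ^ p)
    (h.2.2.2.1.continuousOn_Ici_of_monotoneOn h.2.2.1) isClosed_Ici h0 h1
    (Eventually.of_forall fun z => Real.rpow_nonneg (abs_nonneg _) p) hu
    (by simpa only [Function.comp_def, hr] using hf)
  simpa only [hr] using key

lemma rpow_setAverage_le {p : ℝ} (hp : 1 ≤ p) {X : Type*} [MeasurableSpace X] {μ : Measure X}
    {S : Set X} {v : X → ℝ} (h0 : μ S ≠ 0) (h1 : μ S ≠ ⊤) (hv : ∀ z, 0 ≤ v z)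
    (hi : IntegrableOn v S μ) (hip : IntegrableOn (fun z => v z ^ p) S μ) :
    (⨍ z in S, v z ∂μ) ^ p ≤ ⨍ z in S, v z ^ p ∂μ :=
  (convexOn_rpow hp).map_set_average_le
    (Real.continuous_rpow_const (zero_le_one.trans hp)).continuousOn isClosed_Ici h0 h1
    (Eventually.of_forall hv) hi hip

lemma exists_le_rpow_sub_rpow {κ : ℝ} (hκ : 0 < κ) :
    ∃ c : ℝ, 0 < c ∧ ∀ R r₁ r₂ : ℝ, 0 < R → R ≤ r₁ → r₁ < r₂ → r₂ ≤ 2 * R →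
      c * ((r₂ - r₁) * R ^ (κ - 1)) ≤ r₂ ^ κ - r₁ ^ κ := by
  refine ⟨κ * min 1 (2 ^ (κ - 1)), by positivity, fun R r₁ r₂ hR h1 h12 h2 => ?_⟩
  obtain ⟨c, ⟨hc1, hc2⟩, hc⟩ := exists_deriv_eq_slope (fun x : ℝ => x ^ κ) h12
    (fun x hx => (Real.continuousAt_rpow_const x κ
      (Or.inl (by linarith [hx.1]))).continuousWithinAt)
    fun x hx => (Real.hasDerivAt_rpow_const (p := κ)
      (Or.inl (by linarith [hx.1]))).differentiableAt.differentiableWithinAt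
  rw [(Real.hasDerivAt_rpow_const (Or.inl (by linarith))).deriv,
    eq_div_iff (sub_pos.2 h12).ne'] at hc
  rw [← hc]
  have hcR : min 1 (2 ^ (κ - 1)) * R ^ (κ - 1) ≤ c ^ (κ - 1) := by
    rcases le_total 1 κ with hk | hk
    · calc min 1 (2 ^ (κ - 1)) * R ^ (κ - 1) ≤ 1 * R ^ (κ - 1) := by
            gcongr
            exact min_le_left _ _
        _ ≤ c ^ (κ - 1) := by
            rw [one_mul]
            exact Real.rpow_le_rpow hR.le (by linarith) (by linarith)
    · calc min 1 (2 ^ (κ - 1)) * R ^ (κ - 1) ≤ 2 ^ (κ - 1) * R ^ (κ - 1) := by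
            gcongr
            exact min_le_right _ _
        _ = (2 * R) ^ (κ - 1) := (Real.mul_rpow (by norm_num) hR.le).symm
        _ ≤ c ^ (κ - 1) :=
            Real.rpow_le_rpow_of_nonpos (by linarith) (by linarith) (by linarith)
  have := mul_le_mul_of_nonneg_left hcR (mul_nonneg hκ.le (sub_pos.2 h12).le)
  linarith

end Convexity

section Cylinders

variable {n : ℕ}

lemma measurableSet_ball0_prod_Ioo (r T : ℝ) : MeasurableSet (ball0 n r ×ˢ Ioo 0 T) :=
  Metric.isOpen_ball.measurableSet.prod measurableSet_Ioo

lemma measurableSet_halfSp : MeasurableSet (halfSp n) :=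
  measurableSet_lt measurable_const measurable_snd

lemma ball0_prod_Ioo_subset_halfSp (r T : ℝ) : ball0 n r ×ˢ Ioo 0 T ⊆ halfSp n :=
  fun _ hz => hz.2.1

lemma ball0_prod_Ioo_subset {r₁ r₂ T₁ T₂ : ℝ} (hr : r₁ ≤ r₂) (hT : T₁ ≤ T₂) :
    ball0 n r₁ ×ˢ Ioo 0 T₁ ⊆ ball0 n r₂ ×ˢ Ioo 0 T₂ :=
  prod_mono (Metric.ball_subset_ball hr) (Ioo_subset_Ioo_right hT)

lemma integrableOn_ball0_prod_Ioo {g : Spc n × ℝ → ℝ}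
    (h : ∀ r : ℝ, 0 < r → IntegrableOn g (cyl n r 1)) (r T : ℝ) :
    IntegrableOn g (ball0 n r ×ˢ Ioo 0 T) := by
  refine (h (max 1 (max r T)) (by positivity)).mono_set ?_
  rw [cyl, Real.rpow_one]
  exact ball0_prod_Ioo_subset (by simp) (by simp)

lemma volume_cyl_toReal (hn : 1 ≤ n) {r κ : ℝ} (hr : 0 < r) :
    (volume (cyl n r κ)).toReal = r ^ n * r ^ κ * (volume (ball0 n 1)).toReal := by
  have : Nontrivial (Spc n) := by
    have : Nonempty (Fin n) := ⟨⟨0, hn⟩⟩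
    infer_instance
  rw [cyl, Measure.volume_eq_prod, Measure.prod_prod, ball0, Measure.addHaar_ball _ _ hr.le,
    Real.volume_Ioo, sub_zero, ENNReal.toReal_mul, ENNReal.toReal_mul,
    ENNReal.toReal_ofReal (by positivity), ENNReal.toReal_ofReal (by positivity),
    finrank_euclideanSpace_fin, ball0]
  ring

lemma volume_ball0_one_toReal_pos : 0 < (volume (ball0 n 1)).toReal :=
  ENNReal.toReal_pos (Metric.measure_ball_pos _ _ one_pos).ne' measure_ball_lt_top.ne

lemma volume_cyl_ne_top (r κ : ℝ) : volume (cyl n r κ) ≠ ⊤ := by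
  rw [cyl, Measure.volume_eq_prod, Measure.prod_prod]
  exact ENNReal.mul_ne_top measure_ball_lt_top.ne measure_Ioo_lt_top.ne

lemma volume_cyl_ne_zero {r : ℝ} (hr : 0 < r) (κ : ℝ) : volume (cyl n r κ) ≠ 0 := by
  rw [cyl, Measure.volume_eq_prod, Measure.prod_prod]
  refine mul_ne_zero (Metric.measure_ball_pos _ _ hr).ne' ?_
  simp [Real.rpow_pos_of_pos hr]

end Cylinders

section EnergyEstimate

variable {n k : ℕ}

lemma abs_setIntegral_halfSp_le {F g : Spc n × ℝ → ℝ} {S : Set (Spc n × ℝ)}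
    (hS : MeasurableSet S) (hSh : S ⊆ halfSp n) (hg : IntegrableOn g S) {K : ℝ}
    (hF : ∀ᵐ z ∂(volume.restrict (halfSp n)), |F z| ≤ S.indicator (fun z => K * g z) z) :
    |∫ z in halfSp n, F z| ≤ K * ∫ z in S, g z := by
  have hi : Integrable (S.indicator fun z => K * g z) (volume.restrict (halfSp n)) :=
    ((integrable_indicator_iff hS).2 (hg.const_mul K)).integrableOn
  refine (norm_integral_le_of_norm_le (f := F) hi hF).trans_eq ?_
  rw [setIntegral_indicator hS, inter_eq_right.2 hSh, integral_const_mul]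

lemma boundary_term_nonneg {ψ : Spc n → ℝ} {η : ℝ → ℝ} {u0 : ℕ → Spc n → ℝ} (hk : 1 ≤ k)
    (hψ : ∀ x, 0 ≤ ψ x) (hη0 : 0 ≤ η 0) (hη : ∀ i, i ≠ 0 → iteratedDeriv i η 0 = 0)
    (hu0 : ∀ᵐ x ∂(volume : Measure (Spc n)), 0 ≤ u0 (k - 1) x) :
    0 ≤ ∫ x : Spc n, ∑ i ∈ Finset.range k, (-1 : ℝ) ^ i * u0 (k - 1 - i) x *
      (tDeriv n)^[i] (fun z => ψ z.1 * η z.2) (x, 0) := by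
  refine integral_nonneg_of_ae ?_
  filter_upwards [hu0] with x hx
  rw [Finset.sum_eq_single_of_mem 0 (Finset.mem_range.2 hk)]
  · simpa using mul_nonneg hx (mul_nonneg (hψ x) hη0)
  · intro i _ hi
    simp [iterate_tDeriv, hη i hi]

lemma setIntegral_le_integral_mul_of_eq_one {g φ : Spc n × ℝ → ℝ} {Q₁ Q₂ : Set (Spc n × ℝ)}
    (hQ₁ : MeasurableSet Q₁) (h1h : Q₁ ⊆ halfSp n) (hg0 : ∀ z, 0 ≤ g z)
    (hg : IntegrableOn g Q₂) (hφ : Continuous φ) (hφ0 : ∀ z, 0 ≤ φ z)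
    (hφ1 : ∀ z, φ z ≤ 1) (hφQ₁ : ∀ z ∈ Q₁, φ z = 1) (hφQ₂ : ∀ z ∈ halfSp n \ Q₂, φ z = 0) :
    ∫ z in Q₁, g z ≤ ∫ z in halfSp n, g z * φ z := by
  have hi : IntegrableOn (fun z => g z * φ z) (halfSp n) := by
    refine IntegrableOn.of_forall_sdiff_eq_zero (s := Q₂) (hg.mul_bdd (c := 1)
      hφ.aestronglyMeasurable (Eventually.of_forall fun z => ?_)) measurableSet_halfSp
      fun z hz => by rw [hφQ₂ z hz, mul_zero]
    rw [Real.norm_of_nonneg (hφ0 z)]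
    exact hφ1 z
  calc ∫ z in Q₁, g z = ∫ z in Q₁, g z * φ z :=
        setIntegral_congr_fun hQ₁ fun z hz => by simp [hφQ₁ z hz]
    _ ≤ _ := setIntegral_mono_set hi
        (Eventually.of_forall fun z => mul_nonneg (hg0 z) (hφ0 z)) h1h.eventuallyLE

lemma exists_energy_estimate (n k m : ℕ) (hk : 1 ≤ k) (hm : 1 ≤ m) (A p : ℝ) (hA : 0 < A) :
    ∃ C : ℝ, 0 < C ∧
      ∀ (a : (Fin n → ℕ) → Spc n × ℝ → ℝ → ℝ) (f : ℝ → ℝ) (u0 : ℕ → Spc n → ℝ)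
        (u : Spc n × ℝ → ℝ), Standing n k m A p a f u0 →
        IsGlobalWeakSol n k m p a f u0 u →
        ∀ r₁ r₂ T₁ T₂ : ℝ, 0 < r₁ → r₁ < r₂ → 0 < T₁ → T₁ < T₂ →
          ∫ z in ball0 n r₁ ×ˢ Ioo 0 T₁, f |u z| ≤
            C / (T₂ - T₁) ^ k *
                (∫ z in (ball0 n r₂ ×ˢ Ioo 0 T₂) \ (ball0 n r₁ ×ˢ Ioo 0 T₁), |u z|) +
              C / (r₂ - r₁) ^ m *
                ∫ z in (ball0 n r₂ ×ˢ Ioo 0 T₂) \ (ball0 n r₁ ×ˢ Ioo 0 T₁), |u z| ^ p := by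
  obtain ⟨Ck, hCk, hbk⟩ := exists_norm_iteratedFDeriv_radialCutoff_le ℝ (Nat.ne_of_gt hk)
  obtain ⟨Cm, hCm, hbm⟩ := exists_norm_iteratedFDeriv_radialCutoff_le (Spc n) (Nat.ne_of_gt hm)
  set N : ℝ := ((mIdx n m).card : ℝ) with hN
  refine ⟨Ck * 2 ^ k + N * A * (Cm * 2 ^ m), by positivity, ?_⟩
  rintro a f u0 u ⟨hco, hF, -, hu0, -, -⟩ ⟨hu, hup, hfu, hweak⟩ r₁ r₂ T₁ T₂ hr hr12 hT hT12
  set Q₁ := ball0 n r₁ ×ˢ Ioo 0 T₁ with hQ₁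
  set Q₂ := ball0 n r₂ ×ˢ Ioo 0 T₂ with hQ₂
  have hdr : 0 < r₂ - r₁ := sub_pos.2 hr12
  have hdT : 0 < T₂ - T₁ := sub_pos.2 hT12
  set b := (r₁ + r₂) / 2 with hb
  set T := (T₁ + T₂) / 2 with hTm
  have hrb : r₁ < b := by linarith
  have hbr : b < r₂ := by linarith
  have hTT : T₁ < T := by linarith
  have hTT' : T < T₂ := by linarith
  set ψ : Spc n → ℝ := radialCutoff r₁ b with hψ
  set η : ℝ → ℝ := radialCutoff T₁ T with hη
  have hψs : ContDiff ℝ (⊤ : ℕ∞) ψ := contDiff_radialCutoff _ _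
  have hηs : ContDiff ℝ (⊤ : ℕ∞) η := contDiff_radialCutoff _ _
  have hψ0 : ∀ x, 0 ≤ ψ x := radialCutoff_nonneg
  have hη0 : ∀ t, 0 ≤ η t := radialCutoff_nonneg
  have hψ1 : ∀ x, ψ x ≤ 1 := radialCutoff_le_one
  have hη1 : ∀ t, η t ≤ 1 := radialCutoff_le_one
  have hψz : ∀ x, r₂ ≤ ‖x‖ → ψ x = 0 := fun x hx =>
    radialCutoff_eq_zero hr.le hrb (hbr.le.trans hx)
  have hηz : ∀ t, T₂ ≤ ‖t‖ → η t = 0 := fun t ht =>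
    radialCutoff_eq_zero hT.le hTT (hTT'.le.trans ht)
  set φ : Spc n × ℝ → ℝ := fun z => ψ z.1 * η z.2 with hφ
  have hφs : ContDiff ℝ (⊤ : ℕ∞) φ := (hψs.comp contDiff_fst).mul (hηs.comp contDiff_snd)
  have hφ0 : ∀ z, 0 ≤ φ z := fun z => mul_nonneg (hψ0 _) (hη0 _)
  have hφ1 : ∀ z, φ z ≤ 1 := fun z => mul_le_one₀ (hψ1 _) (hη0 _) (hη1 _)
  have hφc : HasCompactSupport φ := by
    refine HasCompactSupport.of_support_subset_isCompact
      ((isCompact_closedBall (0 : Spc n) r₂).prod (isCompact_closedBall (0 : ℝ) T₂)) fun z hz => ?_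
    refine ⟨mem_closedBall_zero_iff.2 ?_, mem_closedBall_zero_iff.2 ?_⟩
    · by_contra! h
      exact hz (by simp [hφ, hψz _ h.le])
    · by_contra! h
      exact hz (by simp [hφ, hηz _ h.le])
  -- membership in the two cylinders, for points of the half-space
  have hout : ∀ z ∈ halfSp n, z ∉ Q₂ → r₂ ≤ ‖z.1‖ ∨ T₂ ≤ ‖z.2‖ := by
    intro z hz hzQ
    by_contra! h
    exact hzQ ⟨mem_ball_zero_iff.2 h.1, hz, (le_abs_self _).trans_lt h.2⟩
  have hin : ∀ z ∈ Q₁, ‖z.1‖ < r₁ ∧ ‖z.2‖ < T₁ := by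
    intro z hz
    refine ⟨mem_ball_zero_iff.1 hz.1, ?_⟩
    rw [Real.norm_of_nonneg hz.2.1.le]
    exact hz.2.2
  have hφQ₁ : ∀ z ∈ Q₁, φ z = 1 := fun z hz => by
    simp only [hφ, hψ, hη, radialCutoff_eq_one hr.le hrb (hin z hz).1.le,
      radialCutoff_eq_one hT.le hTT (hin z hz).2.le, mul_one]
  have hφQ₂ : ∀ z ∈ halfSp n \ Q₂, φ z = 0 := fun z hz => by
    rcases hout z hz.1 hz.2 with h | h
    · simp [hφ, hψz _ h]
    · simp [hφ, hηz _ h]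
  have hSm : MeasurableSet (Q₂ \ Q₁) :=
    (measurableSet_ball0_prod_Ioo _ _).diff (measurableSet_ball0_prod_Ioo _ _)
  have hSh : Q₂ \ Q₁ ⊆ halfSp n := sdiff_subset.trans (ball0_prod_Ioo_subset_halfSp _ _)
  -- the time-derivative term
  have htime : |∫ z in halfSp n, (-1 : ℝ) ^ k * u z * (tDeriv n)^[k] φ z| ≤
      Ck * 2 ^ k / (T₂ - T₁) ^ k * ∫ z in Q₂ \ Q₁, |u z| := by
    refine abs_setIntegral_halfSp_le hSm hSh
      ((integrableOn_ball0_prod_Ioo hu _ _).mono_set sdiff_subset).abs ?_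
    filter_upwards [ae_restrict_mem measurableSet_halfSp] with z hz
    rw [hφ, iterate_tDeriv]
    by_cases hzS : z ∈ Q₂ \ Q₁
    · rw [indicator_of_mem hzS]
      have h1 : |iteratedDeriv k η z.2| ≤ Ck * 2 ^ k / (T₂ - T₁) ^ k := by
        have h := hbk T₁ T hT hTT z.2
        rw [norm_iteratedFDeriv_eq_norm_iteratedDeriv] at h
        refine h.trans_eq ?_
        rw [show T - T₁ = (T₂ - T₁) / 2 by rw [hTm]; ring, div_pow, div_div_eq_mul_div]
      rw [abs_mul, abs_mul, abs_mul, abs_pow, abs_neg, abs_one, one_pow, one_mul, mul_comm,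
        abs_of_nonneg (hψ0 _)]
      gcongr
      exact (mul_le_of_le_one_left (abs_nonneg _) (hψ1 _)).trans h1
    · rw [indicator_of_notMem hzS]
      refine le_of_eq (abs_eq_zero.2 ?_)
      have : ψ z.1 * iteratedDeriv k η z.2 = 0 := by
        by_cases hz2 : z ∈ Q₂
        · have hz1 : z ∈ Q₁ := by_contra fun h => hzS ⟨hz2, h⟩
          rw [iteratedDeriv_eq_iteratedFDeriv, hη, iteratedFDeriv_radialCutoff_of_norm_lt hT.le hTT
            (Nat.ne_of_gt hk) (hin z hz1).2]
          simp
        · rcases hout z hz hz2 with h | h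
          · rw [hψz _ h, zero_mul]
          · rw [iteratedDeriv_eq_iteratedFDeriv, hη,
              iteratedFDeriv_radialCutoff_of_lt_norm hT.le hTT k (hTT'.trans_le h)]
            simp
      simp only [this, mul_zero]
  -- the spatial-derivative term
  have hspace : |∫ z in halfSp n, ∑ α ∈ mIdx n m, (-1 : ℝ) ^ m * a α z (u z) * mDeriv n α φ z| ≤
      N * A * (Cm * 2 ^ m) / (r₂ - r₁) ^ m * ∫ z in Q₂ \ Q₁, |u z| ^ p := by
    refine abs_setIntegral_halfSp_le hSm hSh
      ((integrableOn_ball0_prod_Ioo hup _ _).mono_set sdiff_subset) ?_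
    have hall : ∀ᵐ z ∂(volume.restrict (halfSp n)), ∀ α ∈ mIdx n m,
        ∀ ζ : ℝ, |a α z ζ| ≤ A * |ζ| ^ p :=
      (Finset.eventually_all _).2 fun α hα => (hco α hα).2.2
    filter_upwards [ae_restrict_mem measurableSet_halfSp, hall] with z hz ha
    have hterm : ∀ α ∈ mIdx n m, |(-1 : ℝ) ^ m * a α z (u z) * mDeriv n α φ z| ≤
        A * |u z| ^ p * (‖iteratedFDeriv ℝ m ψ z.1‖ * |η z.2|) := by
      intro α hα
      rw [abs_mul, abs_mul, abs_pow, abs_neg, abs_one, one_pow, one_mul]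
      gcongr
      · exact ha α hα _
      · exact abs_mDeriv_le hψs hα z
    have hsum := (Finset.abs_sum_le_sum_abs _ _).trans (Finset.sum_le_sum hterm)
    rw [Finset.sum_const, nsmul_eq_mul, ← hN] at hsum
    refine hsum.trans ?_
    by_cases hzS : z ∈ Q₂ \ Q₁
    · rw [indicator_of_mem hzS]
      have h1 : ‖iteratedFDeriv ℝ m ψ z.1‖ ≤ Cm * 2 ^ m / (r₂ - r₁) ^ m := by
        refine (hbm r₁ b hr hrb z.1).trans_eq ?_
        rw [show b - r₁ = (r₂ - r₁) / 2 by rw [hb]; ring, div_pow, div_div_eq_mul_div]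
      have h2 : |η z.2| ≤ 1 := by rw [abs_of_nonneg (hη0 _)]; exact hη1 _
      calc N * (A * |u z| ^ p * (‖iteratedFDeriv ℝ m ψ z.1‖ * |η z.2|))
          ≤ N * (A * |u z| ^ p * (Cm * 2 ^ m / (r₂ - r₁) ^ m * 1)) := by gcongr
        _ = _ := by ring
    · rw [indicator_of_notMem hzS]
      have : ‖iteratedFDeriv ℝ m ψ z.1‖ * |η z.2| = 0 := by
        by_cases hz2 : z ∈ Q₂
        · have hz1 : z ∈ Q₁ := by_contra fun h => hzS ⟨hz2, h⟩
          rw [hψ, iteratedFDeriv_radialCutoff_of_norm_lt hr.le hrb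
            (Nat.ne_of_gt hm) (hin z hz1).1, norm_zero, zero_mul]
        · rcases hout z hz hz2 with h | h
          · rw [hψ, iteratedFDeriv_radialCutoff_of_lt_norm hr.le hrb m (hbr.trans_le h),
              norm_zero, zero_mul]
          · rw [hηz _ h, abs_zero, mul_zero]
      rw [this, mul_zero, mul_zero]
  have hbdry := boundary_term_nonneg (u0 := u0) hk hψ0 (hη0 0) (fun i hi => by
    rw [iteratedDeriv_eq_iteratedFDeriv, hη, iteratedFDeriv_radialCutoff_of_norm_lt hT.le hTT hi
      (by simpa using hT)]
    simp) hu0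
  have hsource := setIntegral_le_integral_mul_of_eq_one
    (measurableSet_ball0_prod_Ioo r₁ T₁) (ball0_prod_Ioo_subset_halfSp r₁ T₁)
    (fun z => hF.nonneg (abs_nonneg (u z))) (integrableOn_ball0_prod_Ioo hfu r₂ T₂)
    hφs.continuous hφ0 hφ1 hφQ₁ hφQ₂
  have hw := hweak φ hφs hφc hφ0
  have hI1 : 0 ≤ ∫ z in Q₂ \ Q₁, |u z| := integral_nonneg fun z => abs_nonneg _
  have hIp : 0 ≤ ∫ z in Q₂ \ Q₁, |u z| ^ p :=
    integral_nonneg fun z => Real.rpow_nonneg (abs_nonneg _) _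
  have h1 : Ck * 2 ^ k / (T₂ - T₁) ^ k * (∫ z in Q₂ \ Q₁, |u z|) ≤
      (Ck * 2 ^ k + N * A * (Cm * 2 ^ m)) / (T₂ - T₁) ^ k * ∫ z in Q₂ \ Q₁, |u z| := by
    gcongr
    exact le_add_of_nonneg_right (by positivity)
  have h2 : N * A * (Cm * 2 ^ m) / (r₂ - r₁) ^ m * (∫ z in Q₂ \ Q₁, |u z| ^ p) ≤
      (Ck * 2 ^ k + N * A * (Cm * 2 ^ m)) / (r₂ - r₁) ^ m * ∫ z in Q₂ \ Q₁, |u z| ^ p := by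
    gcongr
    exact le_add_of_nonneg_left (by positivity)
  have h3 := (le_abs_self _).trans htime
  have h4 := (neg_le_abs _).trans hspace
  linarith

end EnergyEstimate

section Averages

lemma rpow_inv_mul_setIntegral_le {p : ℝ} (hp : 1 ≤ p) {X : Type*} [MeasurableSpace X]
    {μ : Measure X} {Q S : Set X} {v : X → ℝ} (h0 : μ Q ≠ 0) (h1 : μ Q ≠ ⊤)
    (hS : MeasurableSet S) (hSQ : S ⊆ Q) (hv : ∀ z, 0 ≤ v z) (hi : IntegrableOn v S μ)
    (hip : IntegrableOn (fun z => v z ^ p) S μ) :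
    ((μ Q).toReal⁻¹ * ∫ z in S, v z ∂μ) ^ p ≤ (μ Q).toReal⁻¹ * ∫ z in S, v z ^ p ∂μ := by
  have hpow : (fun z => S.indicator v z ^ p) = S.indicator fun z => v z ^ p := by
    funext z
    by_cases hz : z ∈ S
    · simp [hz]
    · simp [hz, Real.zero_rpow (zero_lt_one.trans_le hp).ne']
  have h := rpow_setAverage_le hp (v := S.indicator v) h0 h1
    (fun z => indicator_nonneg (fun z _ => hv z) z)
    ((integrable_indicator_iff hS).2 hi).integrableOn
    (by rw [hpow]; exact ((integrable_indicator_iff hS).2 hip).integrableOn)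
  rw [hpow, setAverage_eq, setAverage_eq, setIntegral_indicator hS, setIntegral_indicator hS,
    inter_eq_right.2 hSQ] at h
  exact h

lemma GoodF.mul_apply_rpow_le {n : ℕ} {p κ R r : ℝ} {f : ℝ → ℝ} {u : Spc n × ℝ → ℝ}
    (h : GoodF p f) (hn : 1 ≤ n) (hp : 0 < p) (hκ : 0 < κ) (hR : 0 < R) (hRr : R ≤ r)
    (hr : r ≤ 2 * R) (hup : ∀ r : ℝ, 0 < r → IntegrableOn (fun z => |u z| ^ p) (cyl n r 1))
    (hfu : ∀ r : ℝ, 0 < r → IntegrableOn (fun z => f |u z|) (cyl n r 1)) :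
    (2 ^ n * 2 ^ κ)⁻¹ * f (((volume (cyl n (2 * R) κ)).toReal⁻¹ *
        ∫ z in cyl n r κ, |u z| ^ p) ^ (1 / p)) ≤
      (volume (cyl n (2 * R) κ)).toReal⁻¹ * ∫ z in cyl n r κ, f |u z| := by
  have hr0 : 0 < r := by linarith
  have hω := volume_ball0_one_toReal_pos (n := n)
  have hJ := h.apply_rpow_setAverage_le hp (μ := volume) (u := u) (volume_cyl_ne_zero hr0 κ)
    (volume_cyl_ne_top r κ) (integrableOn_ball0_prod_Ioo hup _ _)
    (integrableOn_ball0_prod_Ioo hfu _ _)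
  rw [setAverage_eq, setAverage_eq, smul_eq_mul, smul_eq_mul, measureReal_def,
    volume_cyl_toReal hn hr0] at hJ
  rw [volume_cyl_toReal hn (by positivity : 0 < 2 * R), Real.mul_rpow (by norm_num) hR.le, mul_pow]
  set ω := (volume (ball0 n 1)).toReal
  set Y := ∫ z in cyl n r κ, |u z| ^ p
  set Z := ∫ z in cyl n r κ, f |u z|
  have hY : 0 ≤ Y := integral_nonneg fun z => Real.rpow_nonneg (abs_nonneg _) _
  have hZ : 0 ≤ Z := integral_nonneg fun z => h.nonneg (abs_nonneg _)
  have hvol : r ^ n * r ^ κ * ω ≤ 2 ^ n * R ^ n * (2 ^ κ * R ^ κ) * ω := by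
    rw [← mul_pow, ← Real.mul_rpow (by norm_num) hR.le]
    gcongr
  have hlow : R ^ n * R ^ κ * ω ≤ r ^ n * r ^ κ * ω := by gcongr
  have hmono : f (((2 ^ n * R ^ n * (2 ^ κ * R ^ κ) * ω)⁻¹ * Y) ^ (1 / p)) ≤
      f (((r ^ n * r ^ κ * ω)⁻¹ * Y) ^ (1 / p)) := by
    refine h.1 (Real.rpow_nonneg (by positivity) _) (Real.rpow_nonneg (by positivity) _) ?_
    gcongr
  calc _ ≤ (2 ^ n * 2 ^ κ)⁻¹ * ((r ^ n * r ^ κ * ω)⁻¹ * Z) := by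
        gcongr
        exact hmono.trans hJ
    _ ≤ (2 ^ n * 2 ^ κ)⁻¹ * ((R ^ n * R ^ κ * ω)⁻¹ * Z) := by gcongr
    _ = _ := by
        rw [← mul_assoc, ← mul_inv]
        congr 2
        ring

lemma le_or_le_of_mul_le_add {c C c₀ p d P F J X : ℝ} {k m : ℕ} (hc : 0 < c) (hC : 0 < C)
    (hc₀ : 0 < c₀) (hp : 0 < p) (hd : 0 < d) (hP : 0 < P) (hF : 0 ≤ F) (hJ : J ^ p ≤ X)
    (h : c * F ≤ C / (c₀ * (d * P)) ^ k * J + C / d ^ m * X) :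
    (c * c₀ ^ k / (2 * C)) ^ p * ((d * P) ^ k * F) ^ p ≤ X ∨ c / (2 * C) * (d ^ m * F) ≤ X := by
  rcases le_total (C / d ^ m * X) (c * F / 2) with h1 | h1
  · left
    have h2 : c * F / 2 ≤ C / (c₀ * (d * P)) ^ k * J := by linarith
    rw [← Real.mul_rpow (by positivity) (by positivity)]
    refine le_trans (Real.rpow_le_rpow (by positivity) ?_ hp.le) hJ
    rw [div_mul_eq_mul_div, le_div_iff₀ (by positivity), mul_pow] at h2
    rw [div_mul_eq_mul_div, div_le_iff₀ (by positivity)]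
    linarith
  · right
    rw [div_mul_eq_mul_div, le_div_iff₀ (by positivity)] at h1
    rw [div_mul_eq_mul_div, div_le_iff₀ (by positivity)]
    linarith

end Averages

/-- **Lemma 3.2.** Let `p ≥ 1`. For every `κ > 0` there is `C > 0`, depending only on
`A, k, m, n, p, κ`, such that for every global weak solution `u`, all `R > 0` and all
`R ≤ r₁ < r₂ ≤ 2R`, with `I(r) = (mes Q_{2R}^κ)⁻¹ ∫_{Q_r^κ} |u|^p`, at least one of
`I(r₂) - I(r₁) ≥ C (r₂ - r₁)^{kp} R^{kp(κ-1)} f(I(r₁)^{1/p})^p` or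
`I(r₂) - I(r₁) ≥ C (r₂ - r₁)^m f(I(r₁)^{1/p})` holds. -/
theorem lemma_3_2
    (n k m : ℕ) (hn : 1 ≤ n) (hk : 1 ≤ k) (hm : 1 ≤ m)
    (A p : ℝ) (hA : 0 < A) (hp : 1 ≤ p) (κ : ℝ) (hκ : 0 < κ) :
    ∃ C : ℝ, 0 < C ∧
      ∀ (a : (Fin n → ℕ) → Spc n × ℝ → ℝ → ℝ) (f : ℝ → ℝ) (u0 : ℕ → Spc n → ℝ)
        (u : Spc n × ℝ → ℝ), Standing n k m A p a f u0 →
        IsGlobalWeakSol n k m p a f u0 u →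
        ∀ R r₁ r₂ : ℝ, 0 < R → R ≤ r₁ → r₁ < r₂ → r₂ ≤ 2 * R →
        ∀ I : ℝ → ℝ,
          (∀ r : ℝ, I r = (volume (cyl n (2 * R) κ)).toReal⁻¹ * ∫ z in cyl n r κ, |u z| ^ p) →
          C * ((r₂ - r₁) ^ ((k : ℝ) * p) * R ^ ((k : ℝ) * p * (κ - 1)) * f (I r₁ ^ (1 / p)) ^ p)
              ≤ I r₂ - I r₁ ∨
          C * ((r₂ - r₁) ^ (m : ℕ) * f (I r₁ ^ (1 / p))) ≤ I r₂ - I r₁ := by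
  obtain ⟨C₀, hC₀, henergy⟩ := exists_energy_estimate n k m hk hm A p hA
  obtain ⟨c₀, hc₀, hpow⟩ := exists_le_rpow_sub_rpow hκ
  set c : ℝ := (2 ^ n * 2 ^ κ)⁻¹ with hc
  have hcpos : 0 < c := by positivity
  refine ⟨min ((c * c₀ ^ k / (2 * C₀)) ^ p) (c / (2 * C₀)), by positivity, ?_⟩
  intro a f u0 u hst hsol R r₁ r₂ hR hRr hr hr2 I hI
  have hp0 : 0 < p := by linarith
  have hr1 : 0 < r₁ := by linarith
  have hd : 0 < r₂ - r₁ := sub_pos.2 hr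
  have hF := hst.2.1
  have hup := integrableOn_ball0_prod_Ioo hsol.2.1
  have hT1 : 0 < r₁ ^ κ := Real.rpow_pos_of_pos hr1 κ
  have hT12 : r₁ ^ κ < r₂ ^ κ := Real.rpow_lt_rpow hr1.le hr hκ
  have hsub : cyl n r₁ κ ⊆ cyl n r₂ κ := ball0_prod_Ioo_subset hr.le hT12.le
  have hsub' : cyl n r₂ κ ⊆ cyl n (2 * R) κ :=
    ball0_prod_Ioo_subset hr2 (Real.rpow_le_rpow (by linarith) hr2 hκ.le)
  set V := (volume (cyl n (2 * R) κ)).toReal with hV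
  have hVpos : 0 < V :=
    ENNReal.toReal_pos (volume_cyl_ne_zero (by positivity) κ) (volume_cyl_ne_top _ _)
  have hI0 : 0 ≤ I r₁ := by
    rw [hI]
    exact mul_nonneg (by positivity) (integral_nonneg fun z => Real.rpow_nonneg (abs_nonneg _) _)
  have hIdiff : I r₂ - I r₁ = V⁻¹ * ∫ z in cyl n r₂ κ \ cyl n r₁ κ, |u z| ^ p := by
    rw [hI, hI, ← mul_sub]
    exact congrArg (V⁻¹ * ·)
      (setIntegral_sdiff (measurableSet_ball0_prod_Ioo _ _) (hup _ _) hsub).symm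
  have hsource : c * f (I r₁ ^ (1 / p)) ≤ V⁻¹ * ∫ z in cyl n r₁ κ, f |u z| := by
    rw [hI]
    exact hF.mul_apply_rpow_le (by omega) hp0 hκ hR hRr (by linarith) hsol.2.1 hsol.2.2.1
  have hJ : (V⁻¹ * ∫ z in cyl n r₂ κ \ cyl n r₁ κ, |u z|) ^ p ≤ I r₂ - I r₁ := by
    rw [hIdiff]
    exact rpow_inv_mul_setIntegral_le hp (volume_cyl_ne_zero (by positivity) κ)
      (volume_cyl_ne_top _ _)
      ((measurableSet_ball0_prod_Ioo _ _).diff (measurableSet_ball0_prod_Ioo _ _))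
      (sdiff_subset.trans hsub') (fun z => abs_nonneg (u z))
      ((integrableOn_ball0_prod_Ioo hsol.1 _ _).mono_set sdiff_subset).abs
      ((hup _ _).mono_set sdiff_subset)
  have hJ0 : 0 ≤ V⁻¹ * ∫ z in cyl n r₂ κ \ cyl n r₁ κ, |u z| :=
    mul_nonneg (by positivity) (integral_nonneg fun z => abs_nonneg _)
  have hE := henergy a f u0 u hst hsol r₁ r₂ (r₁ ^ κ) (r₂ ^ κ) hr1 hr hT1 hT12
  have hmain : c * f (I r₁ ^ (1 / p)) ≤
      C₀ / (c₀ * ((r₂ - r₁) * R ^ (κ - 1))) ^ k *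
        (V⁻¹ * ∫ z in cyl n r₂ κ \ cyl n r₁ κ, |u z|) +
      C₀ / (r₂ - r₁) ^ m * (I r₂ - I r₁) := by
    have h1 : C₀ / (r₂ ^ κ - r₁ ^ κ) ^ k ≤ C₀ / (c₀ * ((r₂ - r₁) * R ^ (κ - 1))) ^ k := by
      gcongr
      exact hpow R r₁ r₂ hR hRr hr hr2
    have h2 := mul_le_mul_of_nonneg_left hE (inv_nonneg.2 hVpos.le)
    refine hsource.trans (h2.trans ?_)
    refine le_trans (le_of_eq ?_) (add_le_add_left (mul_le_mul_of_nonneg_right h1 hJ0) _)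
    rw [hIdiff]
    simp only [cyl]
    ring
  have hFn : 0 ≤ f (I r₁ ^ (1 / p)) := hF.nonneg (Real.rpow_nonneg hI0 _)
  have hX : 0 ≤ I r₂ - I r₁ := (Real.rpow_nonneg hJ0 p).trans hJ
  rcases le_or_le_of_mul_le_add hcpos hC₀ hc₀ hp0 hd (Real.rpow_pos_of_pos hR (κ - 1)) hFn hJ
    hmain with h | h
  · left
    refine le_trans (mul_le_mul (min_le_left _ _) (le_of_eq ?_) (by positivity) (by positivity)) h
    rw [Real.mul_rpow (by positivity) hFn, ← Real.rpow_natCast, ← Real.rpow_mul (by positivity),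
      Real.mul_rpow hd.le (by positivity), ← Real.rpow_mul hR.le, mul_comm (κ - 1)]
  · right
    exact (mul_le_mul_of_nonneg_right (min_le_right _ _) (by positivity)).trans h
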